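/- For every integer n ≥ 3, the Sprague–Grundy value of the Closed Geodetic Game on the cycle C_n is 𝒢(C_n) = n mod 2. -/

import Mathlib

open SimpleGraph

/-- mex: least nonnegative integer not in the set. -/
noncomputable def mex (X : Set ℕ) : ℕ := sInf Xᶜ

/-- The interval `I(u,v)`: vertices on some shortest `u`–`v` path. -/
def geodInterval {V : Type*} (G : SimpleGraph V) (u v : V) : Set V :=
  {w | G.dist u w + G.dist w v = G.dist u v}

/-- The geodetic closure `(S)`. -/
def geodClosure {V : Type*} (G : SimpleGraph V) (S : Set V) : Set V :=
  ⋃ u ∈ S, ⋃ v ∈ S, geodInterval G u v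

/-- Sprague–Grundy value of the Closed Geodetic Game on `G` with selected set `S`. -/
noncomputable def grundy {V : Type*} [Fintype V] [DecidableEq V]
    (G : SimpleGraph V) (S : Finset V) : ℕ :=
  mex (Set.range fun v : {v : V // v ∉ geodClosure G ↑S} =>
    grundy G (insert v.1 S))
termination_by Sᶜ.card
decreasing_by
  have hv : (v : V) ∉ S := by
    intro h
    exact v.2 (Set.mem_biUnion (by simpa using h)
      (Set.mem_biUnion (by simpa using h) (by simp [geodInterval])))
  simp only [Finset.compl_insert]
  exact Finset.card_erase_lt_of_mem (by simpa using hv)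

theorem mex_eq_zero {X : Set ℕ} (h : 0 ∉ X) : mex X = 0 :=
  Nat.sInf_eq_zero.2 (Or.inl h)

theorem mex_ne_zero {X : Set ℕ} (h : 0 ∈ X) (hX : X.Finite) : mex X ≠ 0 := by
  intro h0
  have hmem : mex X ∈ Xᶜ := Nat.sInf_mem hX.infinite_compl.nonempty
  rw [h0] at hmem
  exact hmem h

theorem mex_singleton_zero : mex {0} = 1 := by
  have hmem : mex {0} ∈ ({0} : Set ℕ)ᶜ :=
    Nat.sInf_mem (Set.finite_singleton (0 : ℕ)).infinite_compl.nonempty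
  have hle : mex {0} ≤ 1 := Nat.sInf_le (by simp)
  have hne : mex {0} ≠ 0 := by simpa using hmem
  omega

theorem mem_geodClosure {V : Type*} {G : SimpleGraph V} {S : Set V} {w : V} :
    w ∈ geodClosure G S ↔ ∃ u ∈ S, ∃ v ∈ S, G.dist u w + G.dist w v = G.dist u v := by
  simp [geodClosure, geodInterval]

section Grundy

variable {V : Type*} [Fintype V] [DecidableEq V] {G : SimpleGraph V} {S : Finset V}

theorem grundy_eq_zero_of_closure (h : ∀ w, w ∈ geodClosure G (S : Set V)) :
    grundy G S = 0 := by
  rw [grundy]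
  refine mex_eq_zero ?_
  rintro ⟨⟨w, hw⟩, -⟩
  exact hw (h w)

theorem grundy_eq_zero
    (h : ∀ v, v ∉ geodClosure G (S : Set V) → grundy G (insert v S) ≠ 0) :
    grundy G S = 0 := by
  rw [grundy]
  refine mex_eq_zero ?_
  rintro ⟨⟨v, hv⟩, h0⟩
  exact h v hv h0

theorem grundy_ne_zero {v : V} (hv : v ∉ geodClosure G (S : Set V))
    (h : grundy G (insert v S) = 0) : grundy G S ≠ 0 := by
  rw [grundy]
  exact mex_ne_zero ⟨⟨v, hv⟩, h⟩ (Set.finite_range _)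

theorem grundy_empty_eq_one [Nonempty V] (h : ∀ v, grundy G {v} = 0) :
    grundy G ∅ = 1 := by
  obtain ⟨v₀⟩ := ‹Nonempty V›
  rw [grundy, ← mex_singleton_zero]
  congr 1
  ext k
  simp only [Set.mem_range, Set.mem_singleton_iff]
  constructor
  · rintro ⟨⟨v, hv⟩, rfl⟩
    exact h v
  · rintro rfl
    exact ⟨⟨v₀, by simp [mem_geodClosure]⟩, h v₀⟩

end Grundy

theorem cycleGraph_adj_iff_val {n : ℕ} (hn : 3 ≤ n) (u v : Fin n) :
    (cycleGraph n).Adj u v ↔ (u : ℕ) + 1 = v ∨ (v : ℕ) + 1 = u ∨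
      (u : ℕ) + (n - 1) = v ∨ (v : ℕ) + (n - 1) = u := by
  have key : ∀ a b : Fin n, (a - b).val = 1 ↔ (b : ℕ) + 1 = a ∨ (a : ℕ) + (n - 1) = b := by
    intro a b
    have ha := a.isLt
    have hb := b.isLt
    rcases le_or_gt b a with h | h
    · rw [Fin.sub_val_of_le h]
      rw [Fin.le_def] at h
      omega
    · rw [Fin.val_sub, Nat.mod_eq_of_lt (by rw [Fin.lt_def] at h; omega)]
      rw [Fin.lt_def] at h
      omega
  rw [cycleGraph_adj', key, key]
  tauto

theorem cycleGraph_connected_of_three_le {n : ℕ} (hn : 3 ≤ n) : (cycleGraph n).Connected := by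
  obtain ⟨m, rfl⟩ : ∃ m, n = m + 1 := ⟨n - 1, by omega⟩
  exact cycleGraph_connected

theorem cycleGraph_dist_le_sub {n : ℕ} (hn : 3 ≤ n) (d : ℕ) :
    ∀ u v : Fin n, (u : ℕ) + d = v → (cycleGraph n).dist u v ≤ d := by
  induction d with
  | zero =>
    intro u v h
    obtain rfl : u = v := Fin.ext h
    simp
  | succ d ih =>
    intro u v h
    have hv := v.isLt
    let w : Fin n := ⟨u + d, by omega⟩
    have hadj : (cycleGraph n).Adj w v :=
      (cycleGraph_adj_iff_val hn w v).2 (Or.inl h)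
    have htri := (cycleGraph_connected_of_three_le hn).dist_triangle (u := u) (v := w) (w := v)
    have hwv := dist_eq_one_iff_adj.2 hadj
    have huw := ih u w rfl
    omega

theorem cycleGraph_min_le_length {n : ℕ} (hn : 3 ≤ n) {u v : Fin n}
    (p : (cycleGraph n).Walk u v) :
    min ((u - v : ℕ) + (v - u : ℕ)) (n - ((u - v : ℕ) + (v - u : ℕ))) ≤ p.length := by
  induction p with
  | nil => simp
  | @cons u w v h p ih =>
    have hu := u.isLt
    have hv := v.isLt
    have hw := w.isLt
    rw [cycleGraph_adj_iff_val hn] at h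
    rw [Walk.length_cons]
    omega

/-- Distance in the cycle graph: the length of the shorter of the two arcs. -/
theorem cycleGraph_dist {n : ℕ} (hn : 3 ≤ n) (u v : Fin n) :
    (cycleGraph n).dist u v =
      min ((u - v : ℕ) + (v - u : ℕ)) (n - ((u - v : ℕ) + (v - u : ℕ))) := by
  have hconn := cycleGraph_connected_of_three_le hn
  apply le_antisymm
  · wlog huv : u ≤ v generalizing u v
    · have := this v u (le_of_not_ge huv)
      rwa [dist_comm, add_comm (u - v : ℕ)]
    rw [Fin.le_def] at huv
    have hv := v.isLt
    let a : Fin n := ⟨0, by omega⟩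
    let b : Fin n := ⟨n - 1, by omega⟩
    have hab : (cycleGraph n).dist a b = 1 :=
      dist_eq_one_iff_adj.2 ((cycleGraph_adj_iff_val hn a b).2 (by simp [a, b]))
    have hdirect := cycleGraph_dist_le_sub hn (v - u) u v (by omega)
    have hau := cycleGraph_dist_le_sub hn u a u (by simp [a])
    have hvb := cycleGraph_dist_le_sub hn (n - 1 - v) v b (by simp only [b]; omega)
    have h₁ := hconn.dist_triangle (u := u) (v := a) (w := v)
    have h₂ := hconn.dist_triangle (u := a) (v := b) (w := v)
    rw [dist_comm] at hau hvb
    omega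
  · obtain ⟨p, hp⟩ := hconn.exists_walk_length_eq_dist u v
    rw [← hp]
    exact cycleGraph_min_le_length hn p

theorem grundy_cycleGraph_singleton_ne_zero {n : ℕ} (hn : 3 ≤ n) (heven : n % 2 = 0)
    (v : Fin n) : grundy (cycleGraph n) {v} ≠ 0 := by
  have hv := v.isLt
  obtain ⟨x, hx⟩ : ∃ x : Fin n, (x : ℕ) = v + n / 2 ∨ (x : ℕ) + n / 2 = v := by
    by_cases h : (v : ℕ) + n / 2 < n
    · exact ⟨⟨v + n / 2, h⟩, Or.inl rfl⟩
    · exact ⟨⟨v - n / 2, by omega⟩, Or.inr (by simp only; omega)⟩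
  have hxn := x.isLt
  refine grundy_ne_zero (v := x) ?_ (grundy_eq_zero_of_closure fun w => ?_)
  · simp only [mem_geodClosure, cycleGraph_dist hn, Finset.coe_singleton, Set.mem_singleton_iff,
      exists_eq_left]
    omega
  · have hw := w.isLt
    refine mem_geodClosure.2 ⟨x, by simp, v, by simp, ?_⟩
    simp only [cycleGraph_dist hn]
    omega

theorem cycleGraph_dist_eq_sub {n : ℕ} (hn : 3 ≤ n) {u v : Fin n} (huv : u ≤ v)
    (h : 2 * (v - u : ℕ) ≤ n) : (cycleGraph n).dist u v = v - u := by
  rw [Fin.le_def] at huv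
  rw [cycleGraph_dist hn]
  omega

theorem cycleGraph_dist_eq_sub_sub {n : ℕ} (hn : 3 ≤ n) {u v : Fin n} (huv : u ≤ v)
    (h : n ≤ 2 * (v - u : ℕ)) : (cycleGraph n).dist u v = n - (v - u) := by
  rw [Fin.le_def] at huv
  rw [cycleGraph_dist hn]
  omega

theorem cycleGraph_mem_geodClosure_of_le {n : ℕ} (hn : 3 ≤ n) {a b c : Fin n}
    (hab : a ≤ b) (hbc : b ≤ c)
    (h : (cycleGraph n).dist a b + (cycleGraph n).dist b c + (cycleGraph n).dist c a = n)
    {S : Set (Fin n)} (ha : a ∈ S) (hb : b ∈ S) (hc : c ∈ S) (y : Fin n) :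
    y ∈ geodClosure (cycleGraph n) S := by
  have hac := hab.trans hbc
  have hcn := c.isLt
  have hyn := y.isLt
  have hab' := Fin.le_def.1 hab
  have hbc' := Fin.le_def.1 hbc
  obtain ⟨h₁, h₂, h₃⟩ : 2 * (b - a : ℕ) ≤ n ∧ 2 * (c - b : ℕ) ≤ n ∧ n ≤ 2 * (c - a : ℕ) := by
    rw [dist_comm (u := c)] at h
    simp only [cycleGraph_dist hn, Nat.sub_eq_zero_of_le hab', Nat.sub_eq_zero_of_le hbc',
      Nat.sub_eq_zero_of_le (hab'.trans hbc'), zero_add] at h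
    omega
  rcases le_total y a with hya | hya
  · have hya' := Fin.le_def.1 hya
    refine mem_geodClosure.2 ⟨a, ha, c, hc, ?_⟩
    rw [dist_comm, cycleGraph_dist_eq_sub hn hya (by omega),
      cycleGraph_dist_eq_sub_sub hn (hya.trans hac) (by omega),
      cycleGraph_dist_eq_sub_sub hn hac h₃]
    omega
  have hya' := Fin.le_def.1 hya
  rcases le_total y b with hyb | hyb
  · have hyb' := Fin.le_def.1 hyb
    refine mem_geodClosure.2 ⟨a, ha, b, hb, ?_⟩
    rw [cycleGraph_dist_eq_sub hn hya (by omega), cycleGraph_dist_eq_sub hn hyb (by omega),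
      cycleGraph_dist_eq_sub hn hab h₁]
    omega
  have hyb' := Fin.le_def.1 hyb
  rcases le_total y c with hyc | hyc
  · have hyc' := Fin.le_def.1 hyc
    refine mem_geodClosure.2 ⟨b, hb, c, hc, ?_⟩
    rw [cycleGraph_dist_eq_sub hn hyb (by omega), cycleGraph_dist_eq_sub hn hyc (by omega),
      cycleGraph_dist_eq_sub hn hbc h₂]
    omega
  · have hyc' := Fin.le_def.1 hyc
    refine mem_geodClosure.2 ⟨a, ha, c, hc, ?_⟩
    rw [dist_comm (u := y), cycleGraph_dist_eq_sub_sub hn hya (by omega),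
      cycleGraph_dist_eq_sub hn hyc (by omega), cycleGraph_dist_eq_sub_sub hn hac h₃]
    omega

/-- If three vertices split the cycle into geodesic arcs, these arcs cover the cycle. -/
theorem cycleGraph_mem_geodClosure_of_dist_add {n : ℕ} (hn : 3 ≤ n) {a b c : Fin n}
    (h : (cycleGraph n).dist a b + (cycleGraph n).dist b c + (cycleGraph n).dist c a = n)
    {S : Set (Fin n)} (ha : a ∈ S) (hb : b ∈ S) (hc : c ∈ S) (y : Fin n) :
    y ∈ geodClosure (cycleGraph n) S := by
  have hab := (cycleGraph n).dist_comm (u := a) (v := b)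
  have hbc := (cycleGraph n).dist_comm (u := b) (v := c)
  have hca := (cycleGraph n).dist_comm (u := c) (v := a)
  rcases le_total a b with h₁ | h₁ <;> rcases le_total b c with h₂ | h₂
  · exact cycleGraph_mem_geodClosure_of_le hn h₁ h₂ h ha hb hc y
  · rcases le_total a c with h₃ | h₃
    · exact cycleGraph_mem_geodClosure_of_le hn h₃ h₂ (by omega) ha hc hb y
    · exact cycleGraph_mem_geodClosure_of_le hn h₃ h₁ (by omega) hc ha hb y
  · rcases le_total a c with h₃ | h₃
    · exact cycleGraph_mem_geodClosure_of_le hn h₁ h₃ (by omega) hb ha hc y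
    · exact cycleGraph_mem_geodClosure_of_le hn h₂ h₃ (by omega) hb hc ha y
  · exact cycleGraph_mem_geodClosure_of_le hn h₂ h₁ (by omega) hc hb ha y

theorem cycleGraph_exists_dist_add {n : ℕ} (hn : 3 ≤ n) (hodd : n % 2 = 1)
    {v w : Fin n} (hvw : w ≠ v) : ∃ x : Fin n,
      (cycleGraph n).dist v w + (cycleGraph n).dist w x + (cycleGraph n).dist x v = n := by
  have hv := v.isLt
  have hw := w.isLt
  have hne : (w : ℕ) ≠ v := fun h => hvw (Fin.ext h)
  simp only [cycleGraph_dist hn]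
  by_cases h : (v : ℕ) + n / 2 < n
  · by_cases h' : (v : ℕ) < w ∧ (w : ℕ) ≤ v + n / 2
    · by_cases h'' : (v : ℕ) + n / 2 + 1 < n
      · exact ⟨⟨v + n / 2 + 1, h''⟩, by dsimp only; omega⟩
      · exact ⟨⟨0, by omega⟩, by dsimp only; omega⟩
    · exact ⟨⟨v + n / 2, h⟩, by dsimp only; omega⟩
  · by_cases h' : (v : ℕ) - n / 2 ≤ w ∧ (w : ℕ) < v
    · exact ⟨⟨v - n / 2 - 1, by omega⟩, by dsimp only; omega⟩
    · exact ⟨⟨v - n / 2, by omega⟩, by dsimp only; omega⟩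

theorem grundy_cycleGraph_pair_ne_zero {n : ℕ} (hn : 3 ≤ n) (hodd : n % 2 = 1)
    {v w : Fin n} (hvw : w ≠ v) : grundy (cycleGraph n) {w, v} ≠ 0 := by
  obtain ⟨x, hx⟩ := cycleGraph_exists_dist_add hn hodd hvw
  have hconn := cycleGraph_connected_of_three_le hn
  have hxv : x ≠ v := by
    rintro rfl
    rw [dist_self, dist_comm] at hx
    omega
  have hxw : x ≠ w := by
    rintro rfl
    rw [dist_self, dist_comm] at hx
    omega
  have hposv := hconn.pos_dist_of_ne hxv
  have hposw := hconn.pos_dist_of_ne hxw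
  have hvx := (cycleGraph n).dist_comm (u := v) (v := x)
  have hwx := (cycleGraph n).dist_comm (u := w) (v := x)
  have hvw' := (cycleGraph n).dist_comm (u := v) (v := w)
  refine grundy_ne_zero (v := x) ?_ (grundy_eq_zero_of_closure fun y =>
    cycleGraph_mem_geodClosure_of_dist_add hn hx (by simp) (by simp) (by simp) y)
  simp only [mem_geodClosure, Finset.coe_insert, Finset.coe_singleton,
    Set.mem_singleton_iff, Set.mem_insert_iff, exists_eq_or_imp, exists_eq_left, dist_self]
  omega

/-- the Grundy value of the Closed Geodetic Game on the cycle `C n`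
(`n ≥ 3`) is `n % 2`. -/
theorem grundy_cycle (n : ℕ) (hn : 3 ≤ n) :
    grundy (SimpleGraph.cycleGraph n) (∅ : Finset (Fin n)) = n % 2 := by
  rcases Nat.mod_two_eq_zero_or_one n with h | h <;> rw [h]
  · exact grundy_eq_zero fun v _ => grundy_cycleGraph_singleton_ne_zero hn h v
  · have : Nonempty (Fin n) := ⟨⟨0, by omega⟩⟩
    refine grundy_empty_eq_one fun v => grundy_eq_zero fun w hw => ?_
    refine grundy_cycleGraph_pair_ne_zero hn h ?_
    rintro rfl
    exact hw (mem_geodClosure.2 ⟨w, by simp, w, by simp, by simp⟩)
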